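/- Let P be an n-dimensional lattice polytope whose normal fan is Q-Gorenstein of index r. If s ≥ r·τ(P) is an integer, then the adjoint polytope (sP)^(r) is a lattice polytope. In particular, cd(P) − 1 < r·τ(P). -/

import Mathlib

open scoped BigOperators Pointwise

noncomputable section

/-- Pairing `⟨a, x⟩ = ∑ aⱼ xⱼ` of an integer linear functional with a real point. -/
def ipair {n : ℕ} (a : Fin n → ℤ) (x : Fin n → ℝ) : ℝ := ∑ j, (a j : ℝ) * x j

/-- An integer vector is primitive if it is nonzero and not a nontrivial integer
multiple of another integer vector. -/
def IsPrimitive {n : ℕ} (a : Fin n → ℤ) : Prop :=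
  a ≠ 0 ∧ ∀ (k : ℤ) (b : Fin n → ℤ), a = k • b → IsUnit k

/-- The set of integer (lattice) points of `ℝⁿ`. -/
def IntPts (n : ℕ) : Set (Fin n → ℝ) := Set.range (fun z : Fin n → ℤ => fun j => (z j : ℝ))

/-- The dimension of a subset of `ℝⁿ` (the dimension of its affine hull). -/
def setDim {n : ℕ} (S : Set (Fin n → ℝ)) : ℕ := Module.finrank ℝ (vectorSpan ℝ S)

/-- An irredundant facet description `P = {x : A x ≥ b}` of an `n`-dimensional
rational polytope: the rows `aᵢ` of `A` are primitive integer vectors, the right hand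
sides are rational, `P` is bounded and `n`-dimensional, every inequality defines a facet
(a face of dimension `n-1`), and no inequality is repeated. -/
structure PolyDesc (n m : ℕ) : Type where
  hm : 0 < m
  A : Fin m → Fin n → ℤ
  b : Fin m → ℚ
  prim : ∀ i, IsPrimitive (A i)
  bounded : Bornology.IsBounded {x : Fin n → ℝ | ∀ i, (b i : ℝ) ≤ ipair (A i) x}
  fulldim : setDim {x : Fin n → ℝ | ∀ i, (b i : ℝ) ≤ ipair (A i) x} = n
  facet_dim : ∀ i, setDim {x : Fin n → ℝ |
      (∀ j, (b j : ℝ) ≤ ipair (A j) x) ∧ ipair (A i) x = (b i : ℝ)} + 1 = n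
  irredundant : Function.Injective (fun i => (A i, b i))

namespace PolyDesc

variable {n m : ℕ} (D : PolyDesc n m)

/-- The polytope `P` itself. -/
def pts : Set (Fin n → ℝ) := {x | ∀ i, (D.b i : ℝ) ≤ ipair (D.A i) x}

/-- Lattice distance `d_{Fᵢ}(x) = ⟨aᵢ, x⟩ - bᵢ` from (the hyperplane spanned by)
the `i`-th facet. -/
def dF (i : Fin m) (x : Fin n → ℝ) : ℝ := ipair (D.A i) x - (D.b i : ℝ)

/-- Lattice distance `d_P(x) = minᵢ d_{Fᵢ}(x)` from the boundary of `P`. -/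
def dist (x : Fin n → ℝ) : ℝ :=
  Finset.univ.inf'
    (Finset.univ_nonempty_iff.mpr (Fin.pos_iff_nonempty.mp D.hm))
    (fun i => D.dF i x)

/-- The adjoint polytope `P⁽ˢ⁾ = {x : d_P(x) ≥ s}`. -/
def adj (s : ℝ) : Set (Fin n → ℝ) := {x | s ≤ D.dist x}

/-- The `i`-th facet `Fᵢ` of `P`. -/
def facet (i : Fin m) : Set (Fin n → ℝ) := {x ∈ D.pts | ipair (D.A i) x = (D.b i : ℝ)}

/-- The set `{s > 0 : P⁽ˢ⁾ ≠ ∅}`, whose supremum is `μ(P)⁻¹`. -/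
def qcdInvSet : Set ℝ := {s : ℝ | 0 < s ∧ (D.adj s).Nonempty}

/-- `μ(P)⁻¹ = sup {s > 0 : P⁽ˢ⁾ ≠ ∅}`. -/
def qcdInv : ℝ := sSup D.qcdInvSet

/-- The ℚ-codegree `μ(P) = (sup {s > 0 : P⁽ˢ⁾ ≠ ∅})⁻¹`. -/
def qcd : ℝ := D.qcdInv⁻¹

/-- The core `core(P) = P^{(1/μ(P))}`. -/
def core : Set (Fin n → ℝ) := D.adj D.qcdInv

/-- The codegree `cd(P) = min {k ∈ ℕ, k ≥ 1 : int(kP) ∩ ℤⁿ ≠ ∅}`. -/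
def codeg : ℕ := sInf {k : ℕ | 0 < k ∧
  ∃ z : Fin n → ℤ, (fun j => (z j : ℝ)) ∈ interior ((k : ℝ) • D.pts)}

end PolyDesc

/-- The face of `S` on which the linear functional `u` is maximized. -/
def argFace {n : ℕ} (S : Set (Fin n → ℝ)) (u : Fin n → ℝ) : Set (Fin n → ℝ) :=
  {x ∈ S | ∀ y ∈ S, ∑ j, u j * y j ≤ ∑ j, u j * x j}

/-- `S` and `T` have the same normal fan: two linear functionals lie in the same
(relatively open) cone of the normal fan of `S`, i.e. are maximized on the same face
of `S`, iff the same holds for `T`. -/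
def SameNormalFan {n : ℕ} (S T : Set (Fin n → ℝ)) : Prop :=
  ∀ u v : Fin n → ℝ, (argFace S u = argFace S v ↔ argFace T u = argFace T v)

/-- The normal fan of `S` refines the normal fan of `T`. -/
def RefinesNormalFan {n : ℕ} (S T : Set (Fin n → ℝ)) : Prop :=
  ∀ u v : Fin n → ℝ, argFace S u = argFace S v → argFace T u = argFace T v

namespace PolyDesc
variable {n m : ℕ} (D : PolyDesc n m)

/-- `{s > 0 : N(P⁽ˢ⁾) = N(P)}`, whose supremum is `τ(P)⁻¹`. -/
def nefInvSet : Set ℝ := {s : ℝ | 0 < s ∧ SameNormalFan (D.adj s) D.pts}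

/-- `τ(P)⁻¹ = sup {s > 0 : N(P⁽ˢ⁾) = N(P)}`. -/
def nefInv : ℝ := sSup D.nefInvSet

/-- The nef value `τ(P)`. -/
def nefVal : ℝ := D.nefInv⁻¹

/-- The set of inequalities active at `x`; the normal cone of the minimal face of `P`
containing `x` is generated by `{aᵢ : i ∈ active x}`, and all cones of the normal fan
of `P` arise in this way. -/
def active (x : Fin n → ℝ) : Set (Fin m) := {i | ipair (D.A i) x = (D.b i : ℝ)}

/-- The normal cone at the vertex `v` is ℚ-Gorenstein of index `r`, witnessed by the
primitive lattice point `u = u_σ` with `⟨aᵢ, u⟩ = r` for all active `i`. -/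
def VertexQG (v : Fin n → ℝ) (u : Fin n → ℤ) (r : ℤ) : Prop :=
  IsPrimitive u ∧ 0 < r ∧ ∀ i ∈ D.active v, (∑ j, D.A i j * u j) = r

/-- The normal fan of `P` is ℚ-Gorenstein: every maximal cone (normal cone of a
vertex, i.e. of an extreme point) is ℚ-Gorenstein. -/
def QGorenstein : Prop := ∀ v ∈ Set.extremePoints ℝ D.pts, ∃ u r, D.VertexQG v u r

end PolyDesc

/-- The point `v(s) = v + (s/r_σ) • u_σ`. -/
def vmove {n : ℕ} (v : Fin n → ℝ) (s : ℝ) (u : Fin n → ℤ) (r : ℤ) : Fin n → ℝ :=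
  v + (s / (r : ℝ)) • (fun j => ((u j : ℝ)))

/-- The height of a point `y` in the cone generated by `{aᵢ : i ∈ I}`:
`ht(y) = max {∑ λᵢ : λᵢ ≥ 0, ∑ λᵢ aᵢ = y}`. -/
def coneHeight {n m : ℕ} (D : PolyDesc n m) (I : Set (Fin m)) (y : Fin n → ℝ) : ℝ :=
  sSup {t : ℝ | ∃ c : Fin m → ℝ, (∀ i, 0 ≤ c i) ∧ (∀ i ∉ I, c i = 0) ∧
    (y = ∑ i, c i • (fun j => ((D.A i j : ℝ)))) ∧ t = ∑ i, c i}

/-- `P` is α-canonical: for every cone `σ` of the normal fan of `P` (the normal cone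
of the minimal face containing a point `x ∈ P`, generated by `{aᵢ : i ∈ active x}`),
every nonzero lattice point of `σ` has height at least `α`. -/
def AlphaCanonical {n m : ℕ} (D : PolyDesc n m) (α : ℝ) : Prop :=
  ∀ x ∈ D.pts, ∀ z : Fin n → ℤ, z ≠ 0 →
    (∃ c : Fin m → ℝ, (∀ i, 0 ≤ c i) ∧ (∀ i ∉ D.active x, c i = 0) ∧
      ((fun j => ((z j : ℝ))) = ∑ i, c i • (fun j => ((D.A i j : ℝ))))) →
    α ≤ coneHeight D (D.active x) (fun j => ((z j : ℝ)))

/-- `P` is a lattice polytope: the convex hull of finitely many integer points. -/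
def IsLatticePoly {n : ℕ} (P : Set (Fin n → ℝ)) : Prop :=
  ∃ V : Finset (Fin n → ℤ),
    P = convexHull ℝ ((fun z : Fin n → ℤ => fun j => ((z j : ℝ))) '' (V : Set (Fin n → ℤ)))

/-- The `i`-th standard basis vector of `ℝᵗ`. -/
def stdBasisVec (t : ℕ) (i : Fin t) : Fin t → ℝ := fun j => if j = i then 1 else 0

/-- The marking vectors of a Cayley sum: `0, e₁, …, e_t ∈ ℝᵗ`. -/
def cayleyVec (t : ℕ) : Fin (t + 1) → (Fin t → ℝ) :=
  fun j => if h : (j : ℕ) = 0 then 0 else stdBasisVec t ⟨(j : ℕ) - 1, by have := j.isLt; omega⟩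

/-- The Cayley sum `Q₀ * ⋯ * Q_t = conv((Q₀ × {0}) ∪ (Q₁ × {e₁}) ∪ ⋯ ∪ (Q_t × {e_t}))`. -/
def cayleySum {k t : ℕ} (Q : Fin (t + 1) → Set (Fin k → ℝ)) :
    Set ((Fin k → ℝ) × (Fin t → ℝ)) :=
  convexHull ℝ (⋃ j, (Q j) ×ˢ ({cayleyVec t j} : Set (Fin t → ℝ)))

/-- `P ⊆ ℝⁿ` is a Cayley polytope `P₀ * ⋯ * P_t` of length `t+1` of lattice polytopes
`Pⱼ ⊆ ℝᵏ` with `k + t = n`: some affine lattice isomorphism `ℤⁿ ≅ ℤᵏ × ℤᵗ`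
identifies `P` with such a Cayley sum. -/
def IsCayley {n : ℕ} (P : Set (Fin n → ℝ)) (k t : ℕ) : Prop :=
  k + t = n ∧
  ∃ Q : Fin (t + 1) → Finset (Fin k → ℤ), (∀ j, (Q j).Nonempty) ∧
  ∃ f : (Fin n → ℝ) ≃ᵃ[ℝ] (Fin k → ℝ) × (Fin t → ℝ),
    f '' IntPts n = (IntPts k) ×ˢ (IntPts t) ∧
    f '' P = cayleySum (fun j =>
      convexHull ℝ ((fun z : Fin k → ℤ => fun i => ((z i : ℝ))) '' (Q j : Set (Fin k → ℤ))))

/-- The unimodular simplex `Δₙ = conv(0, e₁, …, eₙ)`. -/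
def unimodSimplex (n : ℕ) : Set (Fin n → ℝ) :=
  convexHull ℝ (insert (0 : Fin n → ℝ) (Set.range (stdBasisVec n)))

/-- Two subsets of `ℝⁿ` are unimodularly equivalent: an affine lattice automorphism
maps one onto the other. -/
def UnimodEquiv {n : ℕ} (P P' : Set (Fin n → ℝ)) : Prop :=
  ∃ f : (Fin n → ℝ) ≃ᵃ[ℝ] (Fin n → ℝ), f '' IntPts n = IntPts n ∧ f '' P = P'

/-- The codegree `cd(P) = min {k ∈ ℕ, k ≥ 1 : int(kP) ∩ ℤⁿ ≠ ∅}` of a polytope given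
as a set. -/
def codegS {n : ℕ} (P : Set (Fin n → ℝ)) : ℕ :=
  sInf {k : ℕ | 0 < k ∧ ∃ z : Fin n → ℤ, (fun j => (z j : ℝ)) ∈ interior ((k : ℝ) • P)}

/-- `P` has lattice width one: some nonzero integer linear functional has minimum `c`
and maximum `c + 1` on `P`. -/
def HasLatticeWidthOne {n : ℕ} (P : Set (Fin n → ℝ)) : Prop :=
  ∃ u : Fin n → ℤ, u ≠ 0 ∧ ∃ c : ℤ,
    (∀ x ∈ P, (c : ℝ) ≤ ipair u x ∧ ipair u x ≤ (c : ℝ) + 1) ∧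
    (∃ x ∈ P, ipair u x = (c : ℝ)) ∧ (∃ x ∈ P, ipair u x = (c : ℝ) + 1)

/-- `P` is a lattice pyramid: for some primitive `u`, `P` is the convex hull of a base
lying in the lattice hyperplane `{⟨u, ·⟩ = c}` and an apex at lattice distance one from
it (this is equivalent to being unimodularly equivalent to
`conv((Q × {0}) ∪ {(0, …, 0, 1)})` for an `(n-1)`-dimensional lattice polytope `Q`). -/
def IsLatticePyramid {n : ℕ} (P : Set (Fin n → ℝ)) : Prop :=
  ∃ u : Fin n → ℤ, IsPrimitive u ∧ ∃ c : ℤ, ∃ apex ∈ P,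
    ipair u apex = (c : ℝ) + 1 ∧
    P = convexHull ℝ ({x ∈ P | ipair u x = (c : ℝ)} ∪ {apex})

/-- `F` is a facet of `S`: an exposed face of dimension `dim S - 1`. -/
def IsFacetOf {n : ℕ} (F S : Set (Fin n → ℝ)) : Prop :=
  IsExposed ℝ S F ∧ F.Nonempty ∧ setDim F + 1 = setDim S

/-- The polyhedron `{x : A x ≥ β}` with the facet normals of `D` and right hand side `β`. -/
def PolyDesc.poly {n m : ℕ} (D : PolyDesc n m) (β : Fin m → ℝ) : Set (Fin n → ℝ) :=
  {x | ∀ i, β i ≤ ipair (D.A i) x}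

lemma ipair_add {n : ℕ} (a : Fin n → ℤ) (x y : Fin n → ℝ) :
    ipair a (x + y) = ipair a x + ipair a y := by
  simp [ipair, mul_add, Finset.sum_add_distrib]

lemma ipair_smul {n : ℕ} (a : Fin n → ℤ) (c : ℝ) (x : Fin n → ℝ) :
    ipair a (c • x) = c * ipair a x := by
  simp only [ipair, Finset.mul_sum, Pi.smul_apply, smul_eq_mul]
  exact Finset.sum_congr rfl fun _ _ => by ring

lemma ipair_sub {n : ℕ} (a : Fin n → ℤ) (x y : Fin n → ℝ) :
    ipair a (x - y) = ipair a x - ipair a y := by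
  simp [ipair, mul_sub, Finset.sum_sub_distrib]

lemma continuous_ipair {n : ℕ} (a : Fin n → ℤ) : Continuous (ipair a) := by
  unfold ipair
  fun_prop

lemma mem_argFace {n : ℕ} {S : Set (Fin n → ℝ)} {u x : Fin n → ℝ} :
    x ∈ argFace S u ↔ x ∈ S ∧ ∀ y ∈ S, u ⬝ᵥ y ≤ u ⬝ᵥ x := Iff.rfl

lemma isExposed_argFace {n : ℕ} (S : Set (Fin n → ℝ)) (u : Fin n → ℝ) :
    IsExposed ℝ S (argFace S u) := by
  intro _
  refine ⟨∑ j, u j • ContinuousLinearMap.proj j, ?_⟩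
  ext x
  simp [argFace]

lemma argFace_nonempty {n : ℕ} {S : Set (Fin n → ℝ)} (hS : IsCompact S) (hne : S.Nonempty)
    (u : Fin n → ℝ) : (argFace S u).Nonempty := by
  obtain ⟨x, hx, hmax⟩ := hS.exists_isMaxOn hne
    (f := fun x => ∑ j, u j * x j) (by fun_prop)
  exact ⟨x, hx, fun y hy => hmax hy⟩

/-- Every functional is maximized over a nonempty compact set at some extreme point. -/
lemma exists_extremePoint_mem_argFace {n : ℕ} {S : Set (Fin n → ℝ)} (hS : IsCompact S)
    (hne : S.Nonempty) (u : Fin n → ℝ) : ∃ v ∈ S.extremePoints ℝ, v ∈ argFace S u := by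
  have hexp := isExposed_argFace S u
  obtain ⟨v, hv⟩ := (hexp.isCompact hS).extremePoints_nonempty (argFace_nonempty hS hne u)
  rw [hexp.isExtreme.extremePoints_eq] at hv
  exact ⟨v, hv.2, hv.1⟩

/-- A face of a compact convex set is determined by the extreme points it contains. -/
lemma argFace_eq_of_extremePoints {n : ℕ} {S W : Set (Fin n → ℝ)} (hS : IsCompact S)
    (hconv : Convex ℝ S) (hW : S.extremePoints ℝ ⊆ W) {u u' : Fin n → ℝ}
    (h : ∀ w ∈ W, w ∈ argFace S u ↔ w ∈ argFace S u') : argFace S u = argFace S u' := by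
  have key : ∀ u, argFace S u =
      closure (convexHull ℝ (argFace S u ∩ S.extremePoints ℝ)) := fun u => by
    have hexp := isExposed_argFace S u
    rw [← hexp.isExtreme.extremePoints_eq,
      closure_convexHull_extremePoints (hexp.isCompact hS) (hexp.convex hconv)]
  rw [key u, key u']
  congr 2
  ext w
  constructor <;> rintro ⟨h1, h2⟩
  · exact ⟨(h w (hW h2)).1 h1, h2⟩
  · exact ⟨(h w (hW h2)).2 h1, h2⟩

lemma argFace_smul_le {n : ℕ} {S : Set (Fin n → ℝ)} {u x w : Fin n → ℝ} {ε : ℝ}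
    (hx : x ∈ argFace S u) (hε : 0 < ε) (hw : x + ε • w ∈ S) : u ⬝ᵥ w ≤ 0 := by
  have := (mem_argFace.1 hx).2 _ hw
  rw [dotProduct_add, dotProduct_smul, smul_eq_mul] at this
  by_contra! hcon
  nlinarith [mul_pos hε hcon]

namespace PolyDesc

variable {n m : ℕ} (D : PolyDesc n m)

lemma pts_eq_poly : D.pts = D.poly fun i => (D.b i : ℝ) := rfl

lemma adj_eq_poly (t : ℝ) : D.adj t = D.poly fun i => (D.b i : ℝ) + t := by
  ext x
  simp only [adj, dist, poly, Set.mem_ofPred_eq, Finset.le_inf'_iff, Finset.mem_univ,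
    forall_true_left, dF]
  exact forall_congr' fun i => by rw [le_sub_iff_add_le, add_comm]

lemma isClosed_poly (β : Fin m → ℝ) : IsClosed (D.poly β) := by
  simp only [poly, Set.ofPred_forall]
  exact isClosed_iInter fun i => isClosed_le continuous_const (continuous_ipair _)

lemma convex_poly (β : Fin m → ℝ) : Convex ℝ (D.poly β) := by
  intro x hx y hy a b ha hb hab i
  rw [ipair_add, ipair_smul, ipair_smul]
  have h1 := mul_le_mul_of_nonneg_left (hx i) ha
  have h2 := mul_le_mul_of_nonneg_left (hy i) hb
  have h3 : a * β i + b * β i = β i := by rw [← add_mul, hab, one_mul]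
  linarith

lemma poly_subset_pts {t : ℝ} (ht : 0 ≤ t) : (D.poly fun i => (D.b i : ℝ) + t) ⊆ D.pts :=
  fun x hx i => by linarith [hx i]

lemma isCompact_pts : IsCompact D.pts :=
  Metric.isCompact_of_isClosed_isBounded (D.isClosed_poly _) D.bounded

lemma isCompact_poly {t : ℝ} (ht : 0 ≤ t) : IsCompact (D.poly fun i => (D.b i : ℝ) + t) :=
  D.isCompact_pts.of_isClosed_subset (D.isClosed_poly _) (D.poly_subset_pts ht)

lemma dim_pos {n m : ℕ} (D : PolyDesc n m) : 0 < n := by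
  rcases Nat.eq_zero_or_pos n with rfl | h
  · exact absurd (Subsingleton.elim _ _) (D.prim ⟨0, D.hm⟩).1
  · exact h

lemma not_subsingleton_pts : ¬ D.pts.Subsingleton := fun h => by
  have h1 : setDim D.pts = n := D.fulldim
  rw [setDim, vectorSpan_of_subsingleton ℝ h, finrank_bot] at h1
  exact D.dim_pos.ne h1

lemma nonempty_pts : D.pts.Nonempty := by
  by_contra h
  rw [Set.not_nonempty_iff_eq_empty] at h
  exact D.not_subsingleton_pts (h ▸ Set.subsingleton_empty)

/-- A direction that does not decrease any active constraint is feasible. -/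
lemma exists_pos_add_smul_mem {β : Fin m → ℝ} {x w : Fin n → ℝ} (hx : x ∈ D.poly β)
    (hw : ∀ i, ipair (D.A i) x = β i → 0 ≤ ipair (D.A i) w) :
    ∃ ε : ℝ, 0 < ε ∧ x + ε • w ∈ D.poly β := by
  have key : ∀ i, ∀ᶠ ε : ℝ in nhdsWithin 0 (Set.Ioi 0), β i ≤ ipair (D.A i) (x + ε • w) := by
    intro i
    simp only [ipair_add, ipair_smul]
    rcases (hx i).eq_or_lt with h | h
    · filter_upwards [self_mem_nhdsWithin] with ε hε
      have := mul_nonneg (le_of_lt hε) (hw i h.symm)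
      linarith
    · have hc : Continuous fun ε : ℝ => ipair (D.A i) x + ε * ipair (D.A i) w := by fun_prop
      have := (hc.tendsto 0).eventually (lt_mem_nhds (a := β i) (by simpa using h))
      exact nhdsWithin_le_nhds (this.mono fun _ h => h.le)
  obtain ⟨ε, h1, h2⟩ := ((Filter.eventually_all.2 key).and self_mem_nhdsWithin).exists
  exact ⟨ε, h2, h1⟩

/-- The face cut out by a positive combination of constraints that are simultaneously tight at
some point. -/
lemma argFace_neg_sum {β : Fin m → ℝ} {I : Finset (Fin m)} {c : Fin m → ℝ}
    (hc : ∀ i ∈ I, 0 < c i) {y : Fin n → ℝ} (hy : y ∈ D.poly β)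
    (hyI : ∀ i ∈ I, ipair (D.A i) y = β i) :
    argFace (D.poly β) (-∑ i ∈ I, c i • fun j => (D.A i j : ℝ)) =
      {x ∈ D.poly β | ∀ i ∈ I, ipair (D.A i) x = β i} := by
  have hdot : ∀ x, (-∑ i ∈ I, c i • fun j => (D.A i j : ℝ)) ⬝ᵥ x =
      -∑ i ∈ I, c i * ipair (D.A i) x := fun x => by
    rw [neg_dotProduct, sum_dotProduct]
    simp only [smul_dotProduct, smul_eq_mul]
    rfl
  ext x
  rw [mem_argFace]
  simp only [hdot, neg_le_neg_iff, Set.mem_ofPred_eq]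
  refine and_congr_right fun hx => ⟨fun h => ?_, fun h z hz => ?_⟩
  · have hle : ∀ i ∈ I, c i * β i ≤ c i * ipair (D.A i) x :=
      fun i hi => mul_le_mul_of_nonneg_left (hx i) (hc i hi).le
    have heq := (Finset.sum_eq_sum_iff_of_le hle).1 (le_antisymm (Finset.sum_le_sum hle) <| by
      refine (h y hy).trans_eq (Finset.sum_congr rfl fun i hi => by rw [hyI i hi]))
    exact fun i hi => (mul_left_cancel₀ (hc i hi).ne' (heq i hi)).symm
  · exact Finset.sum_le_sum fun i hi =>
      mul_le_mul_of_nonneg_left ((h i hi).trans_le (hz i)) (hc i hi).le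

/-- A vertex is the unique point at which all its active constraints are tight. -/
lemma eq_of_active {v : Fin n → ℝ} (hv : v ∈ Set.extremePoints ℝ D.pts) {w : Fin n → ℝ}
    (hw : ∀ i ∈ D.active v, ipair (D.A i) w = 0) : w = 0 := by
  obtain ⟨ε, hε, h1⟩ := D.exists_pos_add_smul_mem (w := w) hv.1 fun i hi => (hw i hi).ge
  obtain ⟨δ, hδ, h2⟩ := D.exists_pos_add_smul_mem (w := -w) hv.1 fun i hi => by
    have h := hw i hi
    rw [← neg_one_smul ℝ w, ipair_smul, h, mul_zero]
  have hmem : v ∈ openSegment ℝ (v + ε • w) (v + δ • -w) := by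
    refine ⟨δ / (ε + δ), ε / (ε + δ), by positivity, by positivity, by field_simp; ring, ?_⟩
    ext j
    simp only [Pi.add_apply, Pi.smul_apply, Pi.neg_apply, smul_eq_mul]
    field_simp
    ring
  have h3 := hv.2 h1 h2 hmem
  rw [add_eq_left, smul_eq_zero] at h3
  exact h3.resolve_left hε.ne'

lemma exists_argFace_eq_singleton {v : Fin n → ℝ} (hv : v ∈ Set.extremePoints ℝ D.pts) :
    ∃ c, argFace D.pts c = {v} := by
  classical
  let I : Finset (Fin m) := Finset.univ.filter (· ∈ D.active v)
  refine ⟨_, (D.argFace_neg_sum (I := I) (c := fun _ => 1) (fun _ _ => one_pos) hv.1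
    fun i hi => (Finset.mem_filter.1 hi).2).trans ?_⟩
  refine Set.eq_singleton_iff_unique_mem.2 ⟨⟨hv.1, fun i hi => (Finset.mem_filter.1 hi).2⟩,
    fun x hx => sub_eq_zero.1 (D.eq_of_active hv fun i hi => ?_)⟩
  have h1 := hx.2 i (Finset.mem_filter.2 ⟨Finset.mem_univ _, hi⟩)
  have h2 : ipair (D.A i) v = D.b i := hi
  rw [ipair_sub, h1, h2, sub_self]

/-- If `p` satisfies the active constraints of the vertex `v` with equality (for the right hand
side `β`), then a functional maximized at `v` over `P` is bounded by its value at `p`. -/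
lemma dotProduct_le_of_mem_argFace {β : Fin m → ℝ} {v p x u : Fin n → ℝ}
    (hp : ∀ i ∈ D.active v, ipair (D.A i) p = β i) (hv : v ∈ argFace D.pts u)
    (hx : x ∈ D.poly β) : u ⬝ᵥ x ≤ u ⬝ᵥ p := by
  obtain ⟨ε, hε, h⟩ := D.exists_pos_add_smul_mem (w := x - p) hv.1 fun i hi => by
    rw [ipair_sub, hp i hi]
    linarith [hx i]
  have := argFace_smul_le hv hε h
  rw [dotProduct_sub] at this
  linarith

/-- If moving each vertex `v` of `P` to a point `p v` on which the active constraints of `v`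
are tight for `β` stays inside `{A x ≥ β}`, then these points span `{A x ≥ β}`. -/
lemma poly_eq_convexHull {β : Fin m → ℝ} (hfin : (Set.extremePoints ℝ D.pts).Finite)
    {p : (Fin n → ℝ) → Fin n → ℝ}
    (hp : ∀ v ∈ Set.extremePoints ℝ D.pts, ∀ i ∈ D.active v, ipair (D.A i) (p v) = β i)
    (hmem : ∀ v ∈ Set.extremePoints ℝ D.pts, p v ∈ D.poly β) :
    D.poly β = convexHull ℝ (p '' Set.extremePoints ℝ D.pts) := by
  refine Set.Subset.antisymm (fun x hx => ?_)
    (convexHull_min (Set.image_subset_iff.2 hmem) (D.convex_poly β))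
  by_contra hcon
  obtain ⟨f, s, hs, hsx⟩ := geometric_hahn_banach_closed_point (convex_convexHull ℝ _)
    ((hfin.image p).isClosed_convexHull ℝ) hcon
  obtain ⟨u, hu⟩ : ∃ u : Fin n → ℝ, ∀ y, f y = u ⬝ᵥ y :=
    ⟨fun j => f (Pi.single j 1), fun y => by
      have := LinearMap.pi_apply_eq_sum_univ (f : (Fin n → ℝ) →ₗ[ℝ] ℝ) y
      simp only [ContinuousLinearMap.coe_coe, smul_eq_mul] at this
      rw [this]
      refine Finset.sum_congr rfl fun j _ => ?_
      rw [mul_comm]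
      congr 2
      ext k
      simp [Pi.single_apply, eq_comm]⟩
  obtain ⟨v, hv, hvu⟩ := exists_extremePoint_mem_argFace D.isCompact_pts D.nonempty_pts u
  have h1 := D.dotProduct_le_of_mem_argFace (hp v hv) hvu hx
  have h2 := hs _ (subset_convexHull ℝ _ (Set.mem_image_of_mem p hv))
  rw [hu] at h2 hsx
  linarith

/-- An inequality of `D` that becomes tight somewhere on an adjoint polytope is tight at each
vertex minimizing it. -/
lemma mem_active_of_forall_le {t : ℝ} {y v : Fin n → ℝ}
    (hy : y ∈ D.poly fun i => (D.b i : ℝ) + t) {j : Fin m}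
    (hj : ipair (D.A j) y = D.b j + t) (hv : v ∈ Set.extremePoints ℝ D.pts)
    (hmin : ∀ x ∈ D.pts, ipair (D.A j) v ≤ ipair (D.A j) x) : j ∈ D.active v := by
  by_contra hcon
  have hlt : (D.b j : ℝ) < ipair (D.A j) v := lt_of_le_of_ne (hv.1 j) (Ne.symm hcon)
  have hn : n = 1 := by
    have h := D.facet_dim j
    rw [setDim, Set.eq_empty_of_forall_notMem (s := {x : Fin n → ℝ | _}) (fun x hx => ?_),
      vectorSpan_empty, finrank_bot] at h
    · exact h.symm
    · have := hmin x hx.1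
      rw [hx.2] at this
      exact this.not_gt hlt
  subst hn
  have hunit : ∀ i, D.A i 0 = 1 ∨ D.A i 0 = -1 := fun i => by
    refine Int.isUnit_iff.1 ((D.prim i).2 (D.A i 0) 1 ?_)
    ext k
    simp [Subsingleton.elim k 0]
  have hpair : ∀ i x, ipair (D.A i) x = D.A i 0 * x 0 := fun i x => by simp [ipair]
  obtain ⟨i, hi⟩ : (D.active v).Nonempty := by
    by_contra h
    rw [Set.not_nonempty_iff_eq_empty] at h
    have := D.eq_of_active hv (w := 1) (by simp [h])
    exact one_ne_zero this
  have hiv : ipair (D.A i) v = D.b i := hi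
  have hyi := hy i
  by_cases hij : D.A i 0 = D.A j 0
  · have e : ∀ x, ipair (D.A i) x = ipair (D.A j) x := fun x => by rw [hpair, hpair, hij]
    rw [e] at hyi hiv
    simp only at hyi
    linarith
  · have hneg : (D.A i 0 : ℝ) = -D.A j 0 := by
      have : D.A i 0 = -D.A j 0 := by rcases hunit i with h | h <;> rcases hunit j with h' | h' <;> omega
      exact_mod_cast this
    have hj0 : (D.A j 0 : ℝ) ≠ 0 := by
      rcases hunit j with h | h <;> rw [h] <;> norm_num
    have key : ∀ x ∈ D.pts, x = v := fun x hx => by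
      have h1 := hmin x hx
      have h2 := hx i
      rw [← hiv] at h2
      rw [hpair, hpair] at h1 h2
      rw [hneg] at h2
      ext k
      rw [Subsingleton.elim k 0]
      exact mul_left_cancel₀ hj0 (by linarith)
    exact D.not_subsingleton_pts fun x hx z hz => (key x hx).trans (key z hz).symm

lemma poly_nonempty_of_sameNormalFan {β : Fin m → ℝ}
    (h : SameNormalFan (D.poly β) D.pts) : (D.poly β).Nonempty := by
  by_contra hne
  rw [Set.not_nonempty_iff_eq_empty] at hne
  obtain ⟨v, hv⟩ := D.isCompact_pts.extremePoints_nonempty D.nonempty_pts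
  obtain ⟨c, hc⟩ := D.exists_argFace_eq_singleton hv
  have h1 := (h c 0).1 (by simp [argFace, hne])
  rw [hc] at h1
  refine D.not_subsingleton_pts ?_
  have h2 : argFace D.pts 0 = D.pts := by simp [argFace]
  rw [← h2, ← h1]
  exact Set.subsingleton_singleton

/-- If `P⁽ᵗ⁾` and `P` have the same normal fan, the vertex `v` of `P` moves to a point of
`P⁽ᵗ⁾`. -/
lemma mem_poly_of_sameNormalFan {t : ℝ} (ht : 0 < t)
    (h : SameNormalFan (D.poly fun i => (D.b i : ℝ) + t) D.pts) {v p : Fin n → ℝ}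
    (hv : v ∈ Set.extremePoints ℝ D.pts)
    (hp : ∀ i ∈ D.active v, ipair (D.A i) p = D.b i + t) :
    p ∈ D.poly fun i => (D.b i : ℝ) + t := by
  classical
  set Q := D.poly fun i => (D.b i : ℝ) + t with hQ
  obtain ⟨c, hc⟩ := D.exists_argFace_eq_singleton hv
  let act : (Fin n → ℝ) → Finset (Fin m) := fun y =>
    Finset.univ.filter fun i => ipair (D.A i) y = D.b i + t
  have hact : ∀ y i, i ∈ act y ↔ ipair (D.A i) y = D.b i + t := fun y i => by simp [act]
  -- a point of the face in direction `c` with as few tight constraints as possible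
  obtain ⟨y, hyG, hymin⟩ : ∃ y ∈ argFace Q c, ∀ z ∈ argFace Q c, act y ⊆ act z := by
    have hne := argFace_nonempty (D.isCompact_poly ht.le)
      (D.poly_nonempty_of_sameNormalFan h) c
    obtain ⟨y, hy, hyc⟩ := Nat.sInf_mem (hne.image fun y => (act y).card)
    refine ⟨y, hy, fun z hz => ?_⟩
    have hmid : (1 / 2 : ℝ) • y + (1 / 2 : ℝ) • z ∈ argFace Q c :=
      (isExposed_argFace Q c).convex (D.convex_poly _) hy hz
        (by norm_num) (by norm_num) (by norm_num)
    have hsub : act ((1 / 2 : ℝ) • y + (1 / 2 : ℝ) • z) ⊆ act y ∩ act z := fun i hi => by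
      rw [hact, ipair_add, ipair_smul, ipair_smul] at hi
      have h1 := hy.1 i
      have h2 := hz.1 i
      simp only at h1 h2
      rw [Finset.mem_inter, hact, hact]
      constructor <;> linarith
    have hcard : (act y).card ≤ (act ((1 / 2 : ℝ) • y + (1 / 2 : ℝ) • z)).card := by
      have := Nat.sInf_le (Set.mem_image_of_mem (fun y => (act y).card) hmid)
      rw [← hyc] at this
      exact this
    have heq := Finset.eq_of_subset_of_card_le (hsub.trans Finset.inter_subset_left) hcard
    rw [heq] at hsub
    exact hsub.trans Finset.inter_subset_right
  have hyI : ∀ i ∈ act y, ipair (D.A i) y = D.b i + t := fun i hi => (hact y i).1 hi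
  -- positive combinations of the tight constraints cut out the same face of `Q`, hence of `P`
  have hface : ∀ k : Fin m → ℝ, (∀ i ∈ act y, 0 < k i) →
      argFace D.pts (-∑ i ∈ act y, k i • fun j => (D.A i j : ℝ)) = {v} := fun k hk => by
    rw [← hc]
    refine (h _ _).1 ?_
    rw [D.argFace_neg_sum hk hyG.1 hyI]
    ext x
    refine ⟨fun hx => ?_, fun hx => ⟨hx.1, fun i hi => (hact x i).1 (hymin x hx hi)⟩⟩
    obtain ⟨ε, hε, hmem⟩ := D.exists_pos_add_smul_mem (w := y - x) hyG.1 fun i hi => by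
      rw [ipair_sub, hi, hx.2 i ((hact y i).2 hi), sub_self]
    have h1 := argFace_smul_le hyG hε hmem
    rw [dotProduct_sub] at h1
    exact mem_argFace.2 ⟨hx.1, fun z hz => ((mem_argFace.1 hyG).2 z hz).trans (by linarith)⟩
  have hdot : ∀ (k : Fin m → ℝ) x, (-∑ i ∈ act y, k i • fun j => (D.A i j : ℝ)) ⬝ᵥ x =
      -∑ i ∈ act y, k i * ipair (D.A i) x := fun k x => by
    rw [neg_dotProduct, sum_dotProduct]
    simp only [smul_dotProduct, smul_eq_mul]
    rfl
  have hmin : ∀ j ∈ act y, ∀ x ∈ D.pts, ipair (D.A j) v ≤ ipair (D.A j) x := by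
    intro j hj x hx
    have hk : ∀ K : ℝ, 0 ≤ K →
        (∑ i ∈ act y, ipair (D.A i) v) + K * ipair (D.A j) v ≤
          (∑ i ∈ act y, ipair (D.A i) x) + K * ipair (D.A j) x := fun K hK => by
      have hpos : ∀ i ∈ act y, 0 < (1 + if i = j then K else 0 : ℝ) := fun i _ => by
        split_ifs <;> linarith
      have hvf := (hface (fun i => 1 + if i = j then K else 0) hpos).ge rfl
      have h1 := (mem_argFace.1 hvf).2 x hx
      rw [hdot, hdot, neg_le_neg_iff] at h1
      simpa [add_mul, Finset.sum_add_distrib, hj] using h1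
    by_contra! hlt
    have h0 := hk 0 le_rfl
    have hδ : 0 < ipair (D.A j) v - ipair (D.A j) x := by linarith
    have h1 := hk (((∑ i ∈ act y, ipair (D.A i) x) - ∑ i ∈ act y, ipair (D.A i) v) /
      (ipair (D.A j) v - ipair (D.A j) x) + 1)
      (add_nonneg (div_nonneg (by linarith) hδ.le) zero_le_one)
    have h2 := div_mul_cancel₀
      ((∑ i ∈ act y, ipair (D.A i) x) - ∑ i ∈ act y, ipair (D.A i) v) hδ.ne'
    nlinarith
  have hsub : ∀ j ∈ act y, j ∈ D.active v := fun j hj =>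
    D.mem_active_of_forall_le hyG.1 (hyI j hj) hv (hmin j hj)
  obtain ⟨ε, hε, hmem⟩ := D.exists_pos_add_smul_mem (w := y - p) hv.1 fun i hi => by
    rw [ipair_sub, hp i hi]
    have := hyG.1 i
    simp only at this
    linarith
  have hmemf : v + ε • (y - p) ∈
      argFace D.pts (-∑ i ∈ act y, (1 : ℝ) • fun j => (D.A i j : ℝ)) := by
    have := D.argFace_neg_sum (β := fun i => (D.b i : ℝ)) (c := fun _ => 1)
      (fun _ _ => one_pos) hv.1 hsub
    rw [pts_eq_poly, this]
    refine ⟨hmem, fun i hi => ?_⟩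
    have h1 : ipair (D.A i) v = D.b i := hsub i hi
    rw [ipair_add, ipair_smul, ipair_sub, hyI i hi, hp i (hsub i hi), h1]
    ring
  rw [hface (fun _ => 1) fun _ _ => one_pos] at hmemf
  have h1 : v + ε • (y - p) = v := hmemf
  rw [add_eq_left, smul_eq_zero, sub_eq_zero] at h1
  rw [← h1.resolve_left hε.ne']
  exact hyG.1

/-- Moving the vertices of `P` inwards strictly inside the inactive constraints does not change
the normal fan. -/
lemma sameNormalFan_of_move {t : ℝ} (ht : 0 ≤ t) (hfin : (Set.extremePoints ℝ D.pts).Finite)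
    {p : (Fin n → ℝ) → Fin n → ℝ}
    (hp : ∀ v ∈ Set.extremePoints ℝ D.pts, ∀ i ∈ D.active v, ipair (D.A i) (p v) = D.b i + t)
    (hp' : ∀ v ∈ Set.extremePoints ℝ D.pts, ∀ i ∉ D.active v, D.b i + t < ipair (D.A i) (p v)) :
    SameNormalFan (D.poly fun i => (D.b i : ℝ) + t) D.pts := by
  have hmem : ∀ v ∈ Set.extremePoints ℝ D.pts, p v ∈ D.poly fun i => (D.b i : ℝ) + t := by
    intro v hv i
    by_cases hi : i ∈ D.active v
    · exact (hp v hv i hi).ge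
    · exact (hp' v hv i hi).le
  have hiff : ∀ v ∈ Set.extremePoints ℝ D.pts, ∀ u,
      p v ∈ argFace (D.poly fun i => (D.b i : ℝ) + t) u ↔ v ∈ argFace D.pts u := by
    intro v hv u
    refine ⟨fun h => mem_argFace.2 ⟨hv.1, fun x hx => ?_⟩, fun h => mem_argFace.2
      ⟨hmem v hv, fun x hx => D.dotProduct_le_of_mem_argFace (hp v hv) h hx⟩⟩
    obtain ⟨ε, hε, hm⟩ := D.exists_pos_add_smul_mem (w := x - v) h.1 fun i hi => by
      have hia : i ∈ D.active v := by
        by_contra hcon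
        exact (hp' v hv i hcon).ne' hi
      have h1 : ipair (D.A i) v = D.b i := hia
      rw [ipair_sub, h1]
      linarith [hx i]
    have := argFace_smul_le h hε hm
    rw [dotProduct_sub] at this
    linarith
  intro u u'
  constructor <;> intro h
  · refine argFace_eq_of_extremePoints D.isCompact_pts (D.convex_poly _) subset_rfl
      fun v hv => ?_
    rw [← hiff v hv, ← hiff v hv, h]
  · refine argFace_eq_of_extremePoints (W := p '' Set.extremePoints ℝ D.pts)
      (D.isCompact_poly ht) (D.convex_poly _) ?_ ?_
    · rw [D.poly_eq_convexHull hfin hp hmem]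
      exact extremePoints_convexHull_subset
    · rintro _ ⟨v, hv, rfl⟩
      rw [hiff v hv, hiff v hv, h]

lemma bddAbove_nefInvSet : BddAbove D.nefInvSet := by
  obtain ⟨C, hC⟩ := (D.isCompact_pts.image (continuous_ipair (D.A ⟨0, D.hm⟩))).bddAbove
  refine ⟨C - D.b ⟨0, D.hm⟩, ?_⟩
  rintro t ⟨ht, h⟩
  rw [adj_eq_poly] at h
  obtain ⟨x, hx⟩ := D.poly_nonempty_of_sameNormalFan h
  have h1 := hC (Set.mem_image_of_mem _ (D.poly_subset_pts ht.le hx))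
  have h2 := hx ⟨0, D.hm⟩
  simp only at h2
  linarith

lemma nefInv_pos (hfin : (Set.extremePoints ℝ D.pts).Finite) {w : (Fin n → ℝ) → Fin n → ℝ}
    (hw : ∀ v ∈ Set.extremePoints ℝ D.pts, ∀ i ∈ D.active v, ipair (D.A i) (w v) = 1) :
    0 < D.nefInv := by
  have key : ∀ᶠ t : ℝ in nhdsWithin 0 (Set.Ioi 0), ∀ v ∈ Set.extremePoints ℝ D.pts, ∀ i,
      i ∉ D.active v → D.b i + t < ipair (D.A i) (v + t • w v) := by
    refine (Filter.eventually_all_finite hfin).2 fun v hv => Filter.eventually_all.2 fun i => ?_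
    by_cases hi : i ∈ D.active v
    · exact Filter.Eventually.of_forall fun t h => absurd hi h
    have hlt : (D.b i : ℝ) < ipair (D.A i) v := lt_of_le_of_ne (hv.1 i) (Ne.symm hi)
    have hc1 : Continuous fun t : ℝ => (D.b i : ℝ) + t := by fun_prop
    have hc2 : Continuous fun t : ℝ => ipair (D.A i) (v + t • w v) :=
      (continuous_ipair _).comp (by fun_prop)
    have := hc1.continuousAt.eventually_lt (x₀ := 0) hc2.continuousAt (by simpa using hlt)
    exact nhdsWithin_le_nhds (this.mono fun _ h _ => h)
  obtain ⟨t, h, ht⟩ := (key.and self_mem_nhdsWithin).exists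
  have ht : 0 < t := ht
  have hmem : t ∈ D.nefInvSet := by
    refine ⟨ht, ?_⟩
    rw [adj_eq_poly]
    refine D.sameNormalFan_of_move ht.le hfin (p := fun v => v + t • w v)
      (fun v hv i hi => ?_) h
    have h1 : ipair (D.A i) v = D.b i := hi
    rw [ipair_add, ipair_smul, hw v hv i hi, h1, mul_one]
  exact ht.trans_le (le_csSup D.bddAbove_nefInvSet hmem)

lemma add_smul_mem_poly (hpos : 0 < D.nefInv) {v w : Fin n → ℝ}
    (hv : v ∈ Set.extremePoints ℝ D.pts) (hw : ∀ i ∈ D.active v, ipair (D.A i) w = 1)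
    {t : ℝ} (ht : 0 ≤ t) (htle : t ≤ D.nefInv) :
    v + t • w ∈ D.poly fun i => (D.b i : ℝ) + t := by
  have hne : D.nefInvSet.Nonempty := by
    by_contra h
    rw [Set.not_nonempty_iff_eq_empty] at h
    rw [nefInv, h, Real.sSup_empty] at hpos
    exact hpos.false
  have hset : ∀ t' ∈ D.nefInvSet, v + t' • w ∈ D.poly fun i => (D.b i : ℝ) + t' := by
    rintro t' ⟨ht', h⟩
    rw [adj_eq_poly] at h
    refine D.mem_poly_of_sameNormalFan ht' h hv fun i hi => ?_
    have h1 : ipair (D.A i) v = D.b i := hi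
    rw [ipair_add, ipair_smul, hw i hi, h1, mul_one]
  intro i
  have h0 := hv.1 i
  simp only [ipair_add, ipair_smul]
  by_cases hκ : 1 ≤ ipair (D.A i) w
  · nlinarith
  have hκ' : 0 < 1 - ipair (D.A i) w := by linarith
  have hle : D.nefInv ≤ (ipair (D.A i) v - D.b i) / (1 - ipair (D.A i) w) := by
    refine csSup_le hne fun t' ht' => ?_
    have h1 := hset t' ht' i
    simp only [ipair_add, ipair_smul] at h1
    rw [le_div_iff₀ hκ']
    linarith
  have h2 := (le_div_iff₀ hκ').1 (htle.trans hle)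
  linarith

lemma mem_interior_smul_pts {k : ℝ} (hk : 0 < k) {x : Fin n → ℝ}
    (hx : ∀ i, k * D.b i < ipair (D.A i) x) : x ∈ interior (k • D.pts) := by
  refine mem_interior.2 ⟨{y | ∀ i, k * D.b i < ipair (D.A i) y}, fun y hy => ?_, ?_, hx⟩
  · rw [Set.mem_smul_set_iff_inv_smul_mem₀ hk.ne']
    intro i
    rw [ipair_smul, inv_mul_eq_div, le_div_iff₀ hk, mul_comm]
    exact (hy i).le
  · simp only [Set.ofPred_forall]
    exact isOpen_iInter_of_finite fun i => isOpen_lt continuous_const (continuous_ipair _)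

end PolyDesc

/-- Let `P` be an `n`-dimensional lattice polytope whose normal fan
is ℚ-Gorenstein of index `r` (`r` is the lcm of the indices `r_σ` of the maximal
cones, i.e. the least positive integer divisible by all of them). If `s ≥ r·τ(P)` is
an integer, then `(sP)⁽ʳ⁾ = {x : ⟨aᵢ, x⟩ ≥ s bᵢ + r for all i}` is a lattice
polytope. In particular `cd(P) - 1 < r·τ(P)`. -/
theorem statement5 {n m : ℕ} (D : PolyDesc n m) (hlat : IsLatticePoly D.pts)
    (hQG : D.QGorenstein) (r : ℤ)
    (hr : IsLeast {r' : ℤ | 0 < r' ∧ ∀ v ∈ Set.extremePoints ℝ D.pts,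
      ∀ u rv, D.VertexQG v u rv → rv ∣ r'} r) :
    (∀ s : ℤ, (r : ℝ) * D.nefVal ≤ (s : ℝ) →
      IsLatticePoly {x : Fin n → ℝ | ∀ i, (s : ℝ) * (D.b i : ℝ) + (r : ℝ) ≤ ipair (D.A i) x}) ∧
    (D.codeg : ℝ) - 1 < (r : ℝ) * D.nefVal := by
  classical
  obtain ⟨V, hV⟩ := hlat
  have hext : Set.extremePoints ℝ D.pts ⊆
      (fun z : Fin n → ℤ => fun j => ((z j : ℝ))) '' (V : Set (Fin n → ℤ)) := by
    rw [hV]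
    exact extremePoints_convexHull_subset
  have hfin : (Set.extremePoints ℝ D.pts).Finite := (V.finite_toSet.image _).subset hext
  have hint : ∀ v ∈ Set.extremePoints ℝ D.pts, ∃ z : Fin n → ℤ, (fun j => (z j : ℝ)) = v :=
    fun v hv => (hext hv).imp fun _ h => h.2
  choose! z hz using hint
  choose! u rv hu using hQG
  obtain ⟨⟨hr0, hdvd⟩, -⟩ := hr
  have hquot : ∀ v ∈ Set.extremePoints ℝ D.pts, ∃ q, r = rv v * q :=
    fun v hv => hdvd v hv (u v) (rv v) (hu v hv)
  choose! q hq using hquot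
  have hr0' : (0 : ℝ) < r := by exact_mod_cast hr0
  have hupair : ∀ v ∈ Set.extremePoints ℝ D.pts, ∀ i ∈ D.active v,
      ipair (D.A i) (fun j => (u v j : ℝ)) = rv v := fun v hv i hi => by
    have := (hu v hv).2.2 i hi
    rw [ipair]
    exact_mod_cast this
  have hrv : ∀ v ∈ Set.extremePoints ℝ D.pts, (0 : ℝ) < rv v := fun v hv => by
    exact_mod_cast (hu v hv).2.1
  let w : (Fin n → ℝ) → Fin n → ℝ := fun v => (rv v : ℝ)⁻¹ • fun j => (u v j : ℝ)
  have hw : ∀ v ∈ Set.extremePoints ℝ D.pts, ∀ i ∈ D.active v, ipair (D.A i) (w v) = 1 := by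
    intro v hv i hi
    rw [ipair_smul, hupair v hv i hi, inv_mul_cancel₀ (hrv v hv).ne']
  have hpos := D.nefInv_pos hfin hw
  have hτ : 0 < D.nefVal := inv_pos.2 hpos
  let p : ℤ → (Fin n → ℝ) → Fin n → ℤ := fun s v => s • z v + q v • u v
  have main : ∀ s : ℤ, (r : ℝ) * D.nefVal ≤ s →
      {x : Fin n → ℝ | ∀ i, (s : ℝ) * (D.b i : ℝ) + (r : ℝ) ≤ ipair (D.A i) x} =
        convexHull ℝ ((fun v => fun j => (p s v j : ℝ)) '' Set.extremePoints ℝ D.pts) := by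
    intro s hs
    have hs0 : (0 : ℝ) < s := (mul_pos hr0' hτ).trans_le hs
    have hts : (r : ℝ) / s ≤ D.nefInv := by
      rw [PolyDesc.nefVal, ← div_eq_mul_inv, div_le_iff₀ hpos] at hs
      rw [div_le_iff₀ hs0]
      linarith
    have hp : ∀ v ∈ Set.extremePoints ℝ D.pts,
        (fun j => (p s v j : ℝ)) = (s : ℝ) • (v + ((r : ℝ) / s) • w v) := fun v hv => by
      have hqr : (r : ℝ) = rv v * q v := by exact_mod_cast hq v hv
      have := (hrv v hv).ne'
      ext j
      have hzj : (z v j : ℝ) = v j := congrFun (hz v hv) j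
      simp only [p, w, Pi.add_apply, Pi.smul_apply, smul_eq_mul, Int.cast_add, Int.cast_mul,
        hzj, hqr]
      field_simp
    refine D.poly_eq_convexHull (β := fun i => (s : ℝ) * D.b i + r) hfin
      (fun v hv i hi => ?_) (fun v hv i => ?_)
    · have h1 : ipair (D.A i) v = D.b i := hi
      simp only [hp v hv, ipair_smul, ipair_add, hw v hv i hi, h1]
      field_simp
    · have h1 := D.add_smul_mem_poly hpos hv (hw v hv) (div_pos hr0' hs0).le hts i
      have h2 := mul_le_mul_of_nonneg_left h1 hs0.le
      simp only [mul_add, mul_div_cancel₀ (r : ℝ) hs0.ne'] at h2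
      rw [hp v hv, ipair_smul]
      exact h2
  refine ⟨fun s hs => ⟨hfin.toFinset.image (p s), ?_⟩, ?_⟩
  · rw [main s hs, Finset.coe_image, hfin.coe_toFinset, Set.image_image]
  · by_contra! hcon
    have hcpos : (1 : ℝ) < D.codeg := by linarith [mul_pos hr0' hτ]
    have hcpos' : 1 < D.codeg := by exact_mod_cast hcpos
    have hcast : (((D.codeg - 1 : ℕ) : ℤ) : ℝ) = (D.codeg : ℝ) - 1 := by
      rw [Int.cast_natCast, Nat.cast_sub hcpos'.le, Nat.cast_one]
    have hset := main ((D.codeg - 1 : ℕ) : ℤ) (hcast ▸ hcon)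
    obtain ⟨v, hv⟩ := D.isCompact_pts.extremePoints_nonempty D.nonempty_pts
    have hmem := hset.ge (subset_convexHull ℝ _ (Set.mem_image_of_mem _ hv))
    have hle : D.codeg ≤ D.codeg - 1 := Nat.sInf_le ⟨by omega, _,
      D.mem_interior_smul_pts (by rw [← Int.cast_natCast, hcast]; linarith) fun i => by
        have := hmem i
        rw [Int.cast_natCast] at this
        linarith⟩
    omega

end
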